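/- Let X = Σ_{i=1}^n a_i ε_i be a normalized finite Rademacher sum with a_1 ≥ a_2 ≥ ... ≥ a_n > 0, n ≥ 16, and suppose |a_i − 1/4| ≤ 0.03 for each 1 ≤ i ≤ 16. If P(X ≥ 1) < 7/64, then a_1 + a_2 + a_3 + a_4 < 1. -/

import Mathlib

/-- The probability that a finite Rademacher sum with weights `a` (signs chosen
independently and uniformly from `{-1,+1}`) satisfies the predicate `p`. -/
noncomputable def radProb {ι : Type*} [Fintype ι] (a : ι → ℝ) (p : ℝ → Prop) : ℝ :=
  (Nat.card {ε : ι → Bool | p (∑ i, a i * (if ε i then (1 : ℝ) else -1))}) /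
    2 ^ (Fintype.card ι)

open Finset

/-- The value of the signed sum `∑ ± b i` in which exactly the indices in `M` carry a minus sign. -/
def signedSum {ι : Type*} [Fintype ι] [DecidableEq ι] (b : ι → ℝ) (M : Finset ι) : ℝ :=
  ∑ i ∈ Mᶜ, b i - ∑ i ∈ M, b i

lemma mul_card_le_sum {ι : Type*} {b : ι → ℝ} {c : ℝ} (s : Finset ι) (h : ∀ i ∈ s, c ≤ b i) :
    c * #s ≤ ∑ i ∈ s, b i := by
  have := card_nsmul_le_sum s b c h
  rwa [nsmul_eq_mul, mul_comm] at this

lemma sum_le_mul_card {ι : Type*} {b : ι → ℝ} {c : ℝ} (s : Finset ι) (h : ∀ i ∈ s, b i ≤ c) :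
    ∑ i ∈ s, b i ≤ c * #s := by
  have := sum_le_card_nsmul s b c h
  rwa [nsmul_eq_mul, mul_comm] at this

lemma sum_card_filter_powersetCard_le {ι : Type*} [Fintype ι] [DecidableEq ι]
    (p : Finset ι → Prop) [DecidablePred p] (m : ℕ) :
    ∑ r ∈ range m, #{M ∈ powersetCard r (univ : Finset ι) | p M} ≤ #{M | p M} := by
  rw [← card_biUnion]
  · exact card_le_card fun M hM => by
      simp only [mem_biUnion, mem_filter] at hM
      obtain ⟨r, -, -, h⟩ := hM
      simpa using h
  · intro r _ s _ hrs
    exact disjoint_filter_filter ((pairwise_disjoint_powersetCard _) hrs)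

section

variable {b : Fin 16 → ℝ}

lemma le_signedSum (hlo : ∀ i, 0.22 ≤ b i) (hhi : ∀ i, b i ≤ 0.28) (M : Finset (Fin 16)) :
    3.52 - 0.5 * #M ≤ signedSum b M := by
  have h1 := mul_card_le_sum Mᶜ fun i _ => hlo i
  have h2 := sum_le_mul_card M fun i _ => hhi i
  have h3 : (#M + #Mᶜ : ℝ) = 16 := by
    have := card_add_card_compl M
    rw [Fintype.card_fin] at this
    exact_mod_cast this
  unfold signedSum
  linarith

/-- Below the threshold of `le_signedSum`, every set of `r` minus signs counts. -/
lemma card_filter_le_signedSum (hlo : ∀ i, 0.22 ≤ b i) (hhi : ∀ i, b i ≤ 0.28) {t : ℝ} {r : ℕ}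
    (ht : t ≤ 3.52 - 0.5 * r) :
    #{M ∈ powersetCard r (univ : Finset (Fin 16)) | t ≤ signedSum b M} = Nat.choose 16 r := by
  rw [filter_true_of_mem, card_powersetCard, card_univ, Fintype.card_fin]
  intro M hM
  have h := le_signedSum hlo hhi M
  rw [(mem_powersetCard.1 hM).2] at h
  exact ht.trans h

/-- Two disjoint six-element sets of minus signs cannot both yield a signed sum below `0.88`. -/
lemma le_card_filter_powersetCard_six (hlo : ∀ i, 0.22 ≤ b i) {t : ℝ} (ht : t ≤ 0.88) :
    5005 ≤ #{M ∈ powersetCard 6 (univ : Finset (Fin 16)) | t ≤ signedSum b M} := by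
  have hsplit := card_filter_add_card_filter_not (s := powersetCard 6 (univ : Finset (Fin 16)))
    (fun M => t ≤ signedSum b M)
  have hekr := erdos_ko_rado
    (𝒜 := {M ∈ powersetCard 6 (univ : Finset (Fin 16)) | ¬ t ≤ signedSum b M}) (r := 6) ?_ ?_
    (by norm_num)
  · rw [card_powersetCard, card_univ, Fintype.card_fin] at hsplit
    have e1 : Nat.choose 16 6 = 8008 := by decide
    have e2 : Nat.choose (16 - 1) (6 - 1) = 3003 := by decide
    omega
  · intro M hM M' hM' hd
    simp only [coe_filter, Set.mem_ofPred_eq, mem_powersetCard, not_le] at hM hM'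
    have h1 := mul_card_le_sum (M ∪ M')ᶜ fun i _ => hlo i
    have h2 : (#(M ∪ M')ᶜ : ℝ) = 4 := by
      rw [card_compl, card_union_of_disjoint hd, hM.1.2, hM'.1.2]
      norm_num
    have h3 := sum_add_sum_compl (M ∪ M') b
    have h4 := sum_add_sum_compl M b
    have h5 := sum_add_sum_compl M' b
    rw [sum_union hd] at h3
    rw [h2] at h1
    have h6 := hM.2
    have h7 := hM'.2
    unfold signedSum at h6 h7
    linarith
  · intro M hM
    simp only [coe_filter, Set.mem_ofPred_eq, mem_powersetCard] at hM
    exact hM.1.2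

lemma signedSum_of_card_eq_five (hlo : ∀ i, 0.22 ≤ b i) (hhi : ∀ i, b i ≤ 0.28)
    (htop : ∀ i ≤ 3, b 3 ≤ b i) (hbot : ∀ i, 3 < i → b i ≤ b 3) {M : Finset (Fin 16)}
    (hM : #M = 5) : 1.26 - 0.06 * #(M ∩ Iic 3) ≤ signedSum b M := by
  have h1 := mul_card_le_sum (Mᶜ ∩ Iic 3) fun i hi => htop i (by simpa using (mem_inter.1 hi).2)
  have h2 := mul_card_le_sum (Mᶜ \ Iic 3) fun i _ => hlo i
  have h3 := sum_le_mul_card (M ∩ Iic 3) fun i _ => hhi i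
  have h4 := sum_le_mul_card (M \ Iic 3) fun i hi => hbot i (by simpa using (mem_sdiff.1 hi).2)
  have h5 := sum_inter_add_sum_sdiff Mᶜ (Iic 3) b
  have h6 := sum_inter_add_sum_sdiff M (Iic 3) b
  have c1 : (#(M ∩ Iic 3) + #(M \ Iic 3) : ℝ) = 5 := by
    have := card_inter_add_card_sdiff M (Iic 3)
    rw [hM] at this
    exact_mod_cast this
  have c2 : (#(Mᶜ ∩ Iic 3) + #(Mᶜ \ Iic 3) : ℝ) = 11 := by
    have := card_inter_add_card_sdiff Mᶜ (Iic 3)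
    rw [card_compl, hM] at this
    exact_mod_cast this
  have c3 : (#(M ∩ Iic 3) + #(Mᶜ ∩ Iic 3) : ℝ) = 4 := by
    have := card_inter_add_card_sdiff (Iic (3 : Fin 16)) M
    rw [inter_comm, sdiff_eq_inter_compl, inter_comm _ Mᶜ] at this
    exact_mod_cast this
  have e1 : (#(M \ Iic 3) : ℝ) = 5 - #(M ∩ Iic 3) := by linarith
  have e2 : (#(Mᶜ ∩ Iic 3) : ℝ) = 4 - #(M ∩ Iic 3) := by linarith
  have e3 : (#(Mᶜ \ Iic 3) : ℝ) = 7 + #(M ∩ Iic 3) := by linarith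
  rw [e1] at h4
  rw [e2] at h1
  rw [e3] at h2
  unfold signedSum
  have := hhi 3
  nlinarith

lemma le_card_filter_powersetCard_five (hlo : ∀ i, 0.22 ≤ b i) (hhi : ∀ i, b i ≤ 0.28)
    (htop : ∀ i ≤ 3, b 3 ≤ b i) (hbot : ∀ i, 3 < i → b i ≤ b 3) {t : ℝ} (ht : t ≤ 1.14) :
    4056 ≤ #{M ∈ powersetCard 5 (univ : Finset (Fin 16)) | t ≤ signedSum b M} := by
  have hsplit := card_filter_add_card_filter_not (s := powersetCard 5 (univ : Finset (Fin 16)))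
    (fun M => t ≤ signedSum b M)
  have hsub : {M ∈ powersetCard 5 (univ : Finset (Fin 16)) | ¬ t ≤ signedSum b M} ⊆
      (powersetCard 3 (Iic (3 : Fin 16))).biUnion
        fun P => (powersetCard 2 Pᶜ).image fun Q => P ∪ Q := by
    intro M hM
    simp only [mem_filter, mem_powersetCard, not_le] at hM
    have h := signedSum_of_card_eq_five hlo hhi htop hbot hM.1.2
    have h3 : 3 ≤ #(M ∩ Iic 3) := by
      by_contra! hlt
      have : (#(M ∩ Iic 3) : ℝ) ≤ 2 := by exact_mod_cast Nat.le_of_lt_succ hlt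
      linarith [hM.2]
    obtain ⟨P, hP, hPc⟩ := exists_subset_card_eq h3
    have hPM : P ⊆ M := hP.trans inter_subset_left
    refine mem_biUnion.2 ⟨P, mem_powersetCard.2 ⟨hP.trans inter_subset_right, hPc⟩,
      mem_image.2 ⟨M \ P, mem_powersetCard.2 ⟨?_, ?_⟩, union_sdiff_of_subset hPM⟩⟩
    · intro i hi
      simpa using (mem_sdiff.1 hi).2
    · rw [card_sdiff_of_subset hPM, hPc, hM.1.2]
  have hcard := (card_le_card hsub).trans (card_biUnion_le_card_mul _ _ 78 fun P hP => by
    refine card_image_le.trans ?_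
    rw [card_powersetCard, card_compl, (mem_powersetCard.1 hP).2]
    decide)
  rw [card_powersetCard] at hsplit hcard
  have e1 : Nat.choose (#(univ : Finset (Fin 16))) 5 = 4368 := by
    rw [card_univ, Fintype.card_fin]; decide
  have e2 : Nat.choose (#(Iic (3 : Fin 16))) 3 = 4 := by decide
  omega

/-- Among the sign patterns with the first four signs positive and the others balanced, flipping
the balanced part pairs each value with its reflection about the sum of the first four weights. -/
lemma le_card_filter_add_card_filter (hs : 1 ≤ ∑ i ∈ Iic (3 : Fin 16), b i) (z : ℝ) :
    924 ≤ #{M ∈ powersetCard 6 (univ : Finset (Fin 16)) | 1 - z ≤ signedSum b M} +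
      #{M ∈ powersetCard 6 (univ : Finset (Fin 16)) | 1 + z ≤ signedSum b M} := by
  set F := powersetCard 6 (Ioi (3 : Fin 16)) with hF
  have hFc : #F = 924 := by
    rw [hF, card_powersetCard, show #(Ioi (3 : Fin 16)) = 12 by decide]; decide
  have hsplit := card_filter_add_card_filter_not (s := F) (fun M => 1 - z ≤ signedSum b M)
  have hFu : F ⊆ powersetCard 6 univ := powersetCard_mono (subset_univ _)
  have h1 : #{M ∈ F | 1 - z ≤ signedSum b M} ≤
      #{M ∈ powersetCard 6 (univ : Finset (Fin 16)) | 1 - z ≤ signedSum b M} :=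
    card_le_card (filter_subset_filter _ hFu)
  have h2 : #{M ∈ F | ¬ 1 - z ≤ signedSum b M} ≤
      #{M ∈ powersetCard 6 (univ : Finset (Fin 16)) | 1 + z ≤ signedSum b M} := by
    refine card_le_card_of_injOn (fun M => Ioi 3 \ M) ?_ ?_
    · intro M hM
      simp only [hF, coe_filter, Set.mem_ofPred_eq, mem_powersetCard, not_le] at hM
      obtain ⟨⟨hsub, hc⟩, hlt⟩ := hM
      simp only [coe_filter, Set.mem_ofPred_eq, mem_powersetCard, subset_univ, true_and]
      refine ⟨by rw [card_sdiff_of_subset hsub, hc]; decide, ?_⟩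
      have e1 := sum_add_sum_compl M b
      have e2 := sum_add_sum_compl (Ioi 3 \ M) b
      have e3 := sum_sdiff (f := b) hsub
      have e4 := sum_add_sum_compl (Iic 3) b
      rw [show (Iic (3 : Fin 16))ᶜ = Ioi 3 by decide] at e4
      unfold signedSum at hlt ⊢
      linarith
    · intro M hM M' hM' h
      simp only [hF, coe_filter, Set.mem_ofPred_eq, mem_powersetCard] at hM hM'
      have h' : Ioi 3 \ (Ioi 3 \ M) = Ioi 3 \ (Ioi 3 \ M') := congrArg (Ioi 3 \ ·) h
      rwa [Finset.sdiff_sdiff_eq_self hM.1.1, Finset.sdiff_sdiff_eq_self hM'.1.1] at h'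
  omega

lemma le_card_add_card_of_nonneg (hlo : ∀ i, 0.22 ≤ b i) (hhi : ∀ i, b i ≤ 0.28)
    (htop : ∀ i ≤ 3, b 3 ≤ b i) (hbot : ∀ i, 3 < i → b i ≤ b 3)
    (hs : 1 ≤ ∑ i ∈ Iic (3 : Fin 16), b i) {z : ℝ} (hz : 0 ≤ z) :
    14336 ≤ #{M : Finset (Fin 16) | 1 - z ≤ signedSum b M} +
      #{M : Finset (Fin 16) | 1 + z ≤ signedSum b M} := by
  have hm := sum_card_filter_powersetCard_le (fun M => 1 - z ≤ signedSum b M) 7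
  have hp := sum_card_filter_powersetCard_le (fun M => 1 + z ≤ signedSum b M) 7
  have e : ∑ r ∈ range 5, Nat.choose 16 r = 2517 := by decide
  have e5 : Nat.choose 16 5 = 4368 := by decide
  have e6 : Nat.choose 16 6 = 8008 := by decide
  have full {t : ℝ} {r m : ℕ} (hr : r ≤ m) (ht : t ≤ 3.52 - 0.5 * m) :
      #{M ∈ powersetCard r (univ : Finset (Fin 16)) | t ≤ signedSum b M} = Nat.choose 16 r := by
    refine card_filter_le_signedSum hlo hhi (ht.trans ?_)
    have : (r : ℝ) ≤ m := by exact_mod_cast hr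
    linarith
  have low {t : ℝ} (ht : t ≤ 1.52) : ∑ r ∈ range 5,
      #{M ∈ powersetCard r (univ : Finset (Fin 16)) | t ≤ signedSum b M} = 2517 := by
    rw [← e]
    refine sum_congr rfl fun r hr => full (m := 4) (Nat.le_of_lt_succ (mem_range.1 hr)) ?_
    norm_num
    linarith
  rw [sum_range_succ, sum_range_succ] at hm hp
  rw [low (by linarith), full (m := 5) le_rfl (by norm_num; linarith)] at hm
  rcases le_or_gt 0.48 z with h | h
  · rw [full (m := 6) le_rfl (by norm_num; linarith)] at hm
    omega
  rw [low (by linarith)] at hp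
  rcases le_or_gt 0.12 z with h' | h'
  · have := le_card_filter_powersetCard_six hlo (t := 1 - z) (by linarith)
    omega
  · have h5 := le_card_filter_powersetCard_five hlo hhi htop hbot (t := 1 + z) (by linarith)
    have h6 := le_card_filter_add_card_filter hs z
    omega

lemma le_card_add_card (hlo : ∀ i, 0.22 ≤ b i) (hhi : ∀ i, b i ≤ 0.28)
    (htop : ∀ i ≤ 3, b 3 ≤ b i) (hbot : ∀ i, 3 < i → b i ≤ b 3)
    (hs : 1 ≤ ∑ i ∈ Iic (3 : Fin 16), b i) (z : ℝ) :
    14336 ≤ #{M : Finset (Fin 16) | 1 - z ≤ signedSum b M} +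
      #{M : Finset (Fin 16) | 1 + z ≤ signedSum b M} := by
  rcases le_total 0 z with hz | hz
  · exact le_card_add_card_of_nonneg hlo hhi htop hbot hs hz
  · have := le_card_add_card_of_nonneg hlo hhi htop hbot hs (neg_nonneg.2 hz)
    rwa [sub_neg_eq_add, ← sub_eq_add_neg, add_comm] at this

end

lemma sum_mul_sign_eq_signedSum {ι : Type*} [Fintype ι] [DecidableEq ι] (b : ι → ℝ) (ε : ι → Bool) :
    ∑ i, b i * (if ε i then (1 : ℝ) else -1) = signedSum b {i | ε i = false} := by
  rw [signedSum, ← sum_filter_add_sum_filter_not univ (fun i => ε i = false), add_comm,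
    compl_filter, sub_eq_add_neg, ← sum_neg_distrib]
  congr 1 <;> refine sum_congr rfl fun i hi => ?_ <;> simp_all

/-- Sign vectors on `ι` correspond to their sets of negative coordinates. -/
lemma card_sign_filter_eq {ι : Type*} [Fintype ι] [DecidableEq ι] (b : ι → ℝ) (t : ℝ) :
    #{ε : ι → Bool | t ≤ ∑ i, b i * (if ε i then (1 : ℝ) else -1)} =
      #{M : Finset ι | t ≤ signedSum b M} := by
  refine card_bij' (fun ε _ => ({i | ε i = false} : Finset ι)) (fun M _ i => decide (i ∉ M))
    ?_ ?_ ?_ ?_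
  · intro ε h
    simpa only [mem_filter_univ, sum_mul_sign_eq_signedSum] using h
  · intro M h
    simpa only [mem_filter_univ, sum_mul_sign_eq_signedSum, decide_eq_false_iff_not, not_not,
      filter_univ_mem] using h
  · intro ε _
    ext i
    simp
  · intro M _
    ext i
    simp

/-- Conditioning a Rademacher sum on its last `k` signs. -/
lemma card_sign_append_eq_sum {m k : ℕ} (a : Fin (m + k) → ℝ) (t : ℝ) :
    #{ε : Fin (m + k) → Bool | t ≤ ∑ i, a i * (if ε i then (1 : ℝ) else -1)} =
      ∑ δ : Fin k → Bool, #{M : Finset (Fin m) |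
        t - ∑ i, a (Fin.natAdd m i) * (if δ i then (1 : ℝ) else -1) ≤
          signedSum (fun i => a (Fin.castAdd k i)) M} := by
  simp_rw [← card_sign_filter_eq, card_filter]
  rw [← (Fin.appendEquiv m k).sum_comp, Fintype.sum_prod_type_right]
  simp [Fin.appendEquiv, Fin.sum_univ_add]

lemma le_two_mul_card_sign {m k c : ℕ} (a : Fin (m + k) → ℝ)
    (h : ∀ z : ℝ, c ≤
      #{M : Finset (Fin m) | 1 - z ≤ signedSum (fun i => a (Fin.castAdd k i)) M} +
      #{M : Finset (Fin m) | 1 + z ≤ signedSum (fun i => a (Fin.castAdd k i)) M}) :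
    2 ^ k * c ≤
      2 * #{ε : Fin (m + k) → Bool | 1 ≤ ∑ i, a i * (if ε i then (1 : ℝ) else -1)} := by
  set Z : (Fin k → Bool) → ℝ := fun δ =>
    ∑ i, a (Fin.natAdd m i) * (if δ i then (1 : ℝ) else -1) with hZ
  have hneg (δ : Fin k → Bool) : Z (fun i => !δ i) = -Z δ := by
    simp only [hZ, ← sum_neg_distrib]
    refine sum_congr rfl fun i _ => ?_
    by_cases h : δ i <;> simp [h]
  have hflip : ∑ δ, #{M : Finset (Fin m) | 1 - Z δ ≤ signedSum (fun i => a (Fin.castAdd k i)) M} =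
      ∑ δ, #{M : Finset (Fin m) | 1 + Z δ ≤ signedSum (fun i => a (Fin.castAdd k i)) M} := by
    rw [← (Equiv.piCongrRight fun _ : Fin k => Equiv.boolNot).sum_comp]
    refine sum_congr rfl fun δ _ => ?_
    rw [show Z (Equiv.piCongrRight (fun _ : Fin k => Equiv.boolNot) δ) = -Z δ from hneg δ,
      sub_neg_eq_add]
  rw [card_sign_append_eq_sum, two_mul]
  nth_rewrite 2 [hflip]
  rw [← sum_add_distrib]
  calc 2 ^ k * c = ∑ _δ : Fin k → Bool, c := by simp
    _ ≤ _ := sum_le_sum fun δ _ => h (Z δ)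

theorem caseD_a1_add_a2_add_a3_add_a4_lt_one (n : ℕ) (hn : 16 ≤ n) (a : Fin n → ℝ)
    (hmono : ∀ i j : Fin n, i ≤ j → a j ≤ a i) (hpos : ∀ i, 0 < a i)
    (hnorm : ∑ i, (a i) ^ 2 = 1)
    (hclose : ∀ i : Fin n, (i : ℕ) < 16 → |a i - 1 / 4| ≤ 0.03)
    (hX : radProb a (fun x => x ≥ 1) < 7 / 64) :
    a ⟨0, by omega⟩ + a ⟨1, by omega⟩ + a ⟨2, by omega⟩ + a ⟨3, by omega⟩ < 1 := by
  obtain ⟨k, rfl⟩ := Nat.exists_eq_add_of_le hn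
  by_contra! hs
  refine hX.not_ge ?_
  have hc (i : Fin 16) := abs_le.1 (hclose (Fin.castAdd k i) i.isLt)
  have h := le_two_mul_card_sign (c := 14336) a <| le_card_add_card
    (fun i => by linarith [(hc i).1]) (fun i => by linarith [(hc i).2])
    (fun i hi => hmono _ _ hi) (fun i hi => hmono _ _ hi.le)
    (by
      rw [show Iic (3 : Fin 16) = {0, 1, 2, 3} by decide]
      simp only [sum_insert, mem_insert, mem_singleton, sum_singleton, Fin.reduceEq, or_self,
        not_false_eq_true]
      linarith [show a ⟨0, by omega⟩ = a (Fin.castAdd k 0) from rfl,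
        show a ⟨1, by omega⟩ = a (Fin.castAdd k 1) from rfl,
        show a ⟨2, by omega⟩ = a (Fin.castAdd k 2) from rfl,
        show a ⟨3, by omega⟩ = a (Fin.castAdd k 3) from rfl])
  have hcard : Nat.card {ε : Fin (16 + k) → Bool |
      (fun x : ℝ => x ≥ 1) (∑ i, a i * (if ε i then (1 : ℝ) else -1))} =
      #{ε : Fin (16 + k) → Bool | 1 ≤ ∑ i, a i * (if ε i then (1 : ℝ) else -1)} := by
    rw [Nat.card_coe_set_eq, Set.ncard_eq_toFinset_card']
    congr 1
    ext
    simp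
  rw [radProb, hcard, Fintype.card_fin, le_div_iff₀ (by positivity), pow_add]
  have h' : (2 ^ k * 14336 : ℝ) ≤
      2 * #{ε : Fin (16 + k) → Bool | 1 ≤ ∑ i, a i * (if ε i then (1 : ℝ) else -1)} := by
    exact_mod_cast h
  linarith
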